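/- arXiv:2407.21680 — 2 statements merged into one kernel-verified Lean document; each statement's English description precedes it below -/
import Mathlib

section
/- For every natural number N, conjugation of J_N by the lower-triangular Pascal matrix satisfies J_N * Ψ_N = Ψ_N * (−Λ_N * J_N * Λ_N + (N² − 1)•1); equivalently, Ψ_N⁻¹ J_N Ψ_N = −Λ_N J_N Λ_N + (N²−1) I_N. -/
open Matrix

/-- The `N × N` symmetric Pascal matrix, `(T_N)_{jk} = C(j+k, j)`. -/
noncomputable def pascalT (N : ℕ) : Matrix (Fin N) (Fin N) ℝ :=
  fun j k => (Nat.choose (j.1 + k.1) j.1 : ℝ)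

/-- The `N × N` lower-triangular Pascal matrix, `(Ψ_N)_{jk} = C(j, k)`. -/
noncomputable def psiMat (N : ℕ) : Matrix (Fin N) (Fin N) ℝ :=
  fun j k => (Nat.choose j.1 k.1 : ℝ)

/-- The `N × N` diagonal sign matrix `Λ_N = diag(1, -1, 1, …)`. -/
noncomputable def lamMat (N : ℕ) : Matrix (Fin N) (Fin N) ℝ :=
  Matrix.diagonal fun j => (-1 : ℝ) ^ j.1

/-- The `N × N` symmetric tridiagonal (Jacobi) matrix `J_N` with diagonal entries
`(J_N)_{jj} = -N²·j + 2j³ + 3j² + 2j` and off-diagonal entries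
`(J_N)_{j,j+1} = (J_N)_{j+1,j} = (j+1)·(N² - (j+1)²)`. -/
noncomputable def jacobiJ (N : ℕ) : Matrix (Fin N) (Fin N) ℝ :=
  fun j k =>
    if j.1 = k.1 then
      -((N : ℝ) ^ 2) * (j.1 : ℝ) + 2 * (j.1 : ℝ) ^ 3 + 3 * (j.1 : ℝ) ^ 2 + 2 * (j.1 : ℝ)
    else if j.1 + 1 = k.1 then (k.1 : ℝ) * ((N : ℝ) ^ 2 - (k.1 : ℝ) ^ 2)
    else if k.1 + 1 = j.1 then (j.1 : ℝ) * ((N : ℝ) ^ 2 - (j.1 : ℝ) ^ 2)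
    else 0

theorem jacobiJ_comm (N : ℕ) (j k : Fin N) : jacobiJ N j k = jacobiJ N k j := by
  unfold jacobiJ
  split_ifs <;> first | omega | simp_all

/-- The action of a row of the Jacobi matrix is a three-term recurrence with no boundary terms,
since the off-diagonal weight `m (N² - m²)` vanishes at `m = 0` and `m = N`. -/
theorem sum_jacobiJ_mul (N : ℕ) (j : Fin N) (f : ℕ → ℝ) :
    ∑ l : Fin N, jacobiJ N j l * f l
      = (j : ℝ) * ((N : ℝ) ^ 2 - (j : ℝ) ^ 2) * f (j - 1)
        + (-((N : ℝ) ^ 2) * (j : ℝ) + 2 * (j : ℝ) ^ 3 + 3 * (j : ℝ) ^ 2 + 2 * (j : ℝ)) * f j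
        + ((j : ℝ) + 1) * ((N : ℝ) ^ 2 - ((j : ℝ) + 1) ^ 2) * f (j + 1) := by
  obtain ⟨j, hj⟩ := j
  dsimp only
  set A := (j : ℝ) * ((N : ℝ) ^ 2 - (j : ℝ) ^ 2) * f (j - 1) with hA
  set B := (-((N : ℝ) ^ 2) * (j : ℝ) + 2 * (j : ℝ) ^ 3 + 3 * (j : ℝ) ^ 2 + 2 * (j : ℝ)) * f j
    with hB
  set C := ((j : ℝ) + 1) * ((N : ℝ) ^ 2 - ((j : ℝ) + 1) ^ 2) * f (j + 1) with hC
  have hterm : ∀ l : Fin N, jacobiJ N ⟨j, hj⟩ l * f l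
      = (if j - 1 = (l : ℕ) then A else 0) + (if j = (l : ℕ) then B else 0)
        + (if j + 1 = (l : ℕ) then C else 0) := by
    rintro ⟨l, hl⟩
    simp only [jacobiJ]
    rcases Nat.eq_zero_or_pos j with rfl | hpos
    · have hA0 : A = 0 := by simp [hA]
      rw [hA0, ite_self, zero_add]
      split_ifs <;> first | omega | (subst_vars; simp [hB, hC])
    · split_ifs <;> first | omega | (subst_vars; simp [hA, hB, hC])
  rw [Finset.sum_congr rfl fun l _ => hterm l,
    Fin.sum_univ_eq_sum_range (fun l => (if j - 1 = l then A else 0) + (if j = l then B else 0)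
        + (if j + 1 = l then C else 0)) N]
  simp only [Finset.sum_add_distrib, Finset.sum_ite_eq, Finset.mem_range]
  rw [if_pos (by omega : j - 1 < N), if_pos hj]
  split_ifs with h
  · rfl
  · have hN : N = j + 1 := by omega
    have hC0 : C = 0 := by simp [hC, hN]
    rw [hC0]

theorem natCast_mul_choose_sub_one (j k : ℕ) :
    (j : ℝ) * ((j - 1).choose k : ℝ) = ((j : ℝ) - k) * (j.choose k : ℝ) := by
  cases j with
  | zero => cases k <;> simp
  | succ n =>
    rcases le_or_gt k (n + 1) with h | h
    · have := congrArg (Nat.cast : ℕ → ℝ) (Nat.choose_mul_succ_eq n k)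
      push_cast [Nat.cast_sub h] at this ⊢
      linarith
    · simp [Nat.choose_eq_zero_of_lt h, Nat.choose_eq_zero_of_lt (show n < k by omega)]

theorem natCast_add_one_mul_choose_add_one (j k : ℕ) :
    ((k : ℝ) + 1) * (j.choose (k + 1) : ℝ) = ((j : ℝ) - k) * (j.choose k : ℝ) := by
  rcases le_or_gt k j with h | h
  · have := congrArg (Nat.cast : ℕ → ℝ) (Nat.choose_succ_right_eq j k)
    push_cast [Nat.cast_sub h] at this
    linarith
  · simp [Nat.choose_eq_zero_of_lt h, Nat.choose_eq_zero_of_lt (show j < k + 1 by omega)]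

theorem choose_jacobi_identity (x : ℝ) (j k : ℕ) :
    (j : ℝ) * (x - (j : ℝ) ^ 2) * ((j - 1).choose k : ℝ)
        + (-x * (j : ℝ) + 2 * (j : ℝ) ^ 3 + 3 * (j : ℝ) ^ 2 + 2 * (j : ℝ)) * (j.choose k : ℝ)
        + ((j : ℝ) + 1) * (x - ((j : ℝ) + 1) ^ 2) * ((j + 1).choose k : ℝ)
      = (k : ℝ) * (x - (k : ℝ) ^ 2) * (j.choose (k - 1) : ℝ)
        - (-x * (k : ℝ) + 2 * (k : ℝ) ^ 3 + 3 * (k : ℝ) ^ 2 + 2 * (k : ℝ)) * (j.choose k : ℝ)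
        + ((k : ℝ) + 1) * (x - ((k : ℝ) + 1) ^ 2) * (j.choose (k + 1) : ℝ)
        + (x - 1) * (j.choose k : ℝ) := by
  have h₁ := natCast_mul_choose_sub_one j k
  have h₂ := natCast_add_one_mul_choose_add_one j k
  cases k with
  | zero =>
    simp only [Nat.choose_zero_right, Nat.cast_zero, Nat.cast_one] at h₁ h₂ ⊢
    linear_combination -(x - 1) * h₂
  | succ m =>
    have h₃ := natCast_add_one_mul_choose_add_one j m
    rw [Nat.choose_succ_succ j m, Nat.add_sub_cancel]
    push_cast at h₁ h₂ h₃ ⊢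
    linear_combination (x - (j : ℝ) ^ 2) * h₁ - (x - ((m : ℝ) + 1 + 1) ^ 2) * h₂
      - (x - ((j : ℝ) + 1) ^ 2 - ((j : ℝ) + 1) * (m + 1) - ((m : ℝ) + 1) ^ 2) * h₃

/-- Conjugating by `Λ_N` and negating only changes the sign of the diagonal of `J_N`. -/
theorem neg_lamMat_conj_jacobiJ_apply (N : ℕ) (l k : Fin N) :
    -(lamMat N * jacobiJ N * lamMat N) l k
      = jacobiJ N l k - if l = k then 2 * jacobiJ N k k else 0 := by
  have hsq : ∀ n : ℕ, (-1 : ℝ) ^ n * (-1) ^ n = 1 := fun n => by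
    rw [← mul_pow]; norm_num
  rw [lamMat, mul_diagonal, diagonal_mul]
  split_ifs with h
  · subst h
    linear_combination -jacobiJ N l l * hsq l
  · have h' : (l : ℕ) ≠ k := fun e => h (Fin.ext e)
    simp only [jacobiJ, if_neg h']
    split_ifs with h₁ h₂
    · rw [← h₁, pow_succ]
      push_cast
      linear_combination ((l : ℝ) + 1) * ((N : ℝ) ^ 2 - ((l : ℝ) + 1) ^ 2) * hsq l
    · rw [← h₂, pow_succ]
      push_cast
      linear_combination ((k : ℝ) + 1) * ((N : ℝ) ^ 2 - ((k : ℝ) + 1) ^ 2) * hsq k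
    · simp

/-- Conjugation of `J_N` by the lower-triangular Pascal matrix:
`J_N Ψ_N = Ψ_N (-Λ_N J_N Λ_N + (N² - 1)·I)`, i.e. `Ψ_N⁻¹ J_N Ψ_N = -Λ_N J_N Λ_N + (N²-1)·I`. -/
theorem jacobi_conjugation_by_psi (N : ℕ) :
    jacobiJ N * psiMat N
      = psiMat N *
          (-(lamMat N * jacobiJ N * lamMat N) + ((N : ℝ) ^ 2 - 1) • (1 : Matrix (Fin N) (Fin N) ℝ)) := by
  ext j k
  rw [mul_add, mul_smul_comm, mul_one, Matrix.add_apply, Matrix.smul_apply, smul_eq_mul, mul_apply, mul_apply]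
  simp only [Matrix.neg_apply, neg_lamMat_conj_jacobiJ_apply, mul_sub, Finset.sum_sub_distrib, mul_ite,
    mul_zero, Finset.sum_ite_eq', Finset.mem_univ, if_true]
  have hleft := sum_jacobiJ_mul N j fun l => (l.choose k : ℝ)
  have hright := sum_jacobiJ_mul N k fun l => ((j : ℕ).choose l : ℝ)
  have hdiag : jacobiJ N k k
      = -((N : ℝ) ^ 2) * (k : ℝ) + 2 * (k : ℝ) ^ 3 + 3 * (k : ℝ) ^ 2 + 2 * (k : ℝ) := by
    simp [jacobiJ]
  have hcomm : ∑ l, psiMat N j l * jacobiJ N l k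
      = ∑ l : Fin N, jacobiJ N k l * ((j : ℕ).choose l : ℝ) :=
    Finset.sum_congr rfl fun l _ => by rw [jacobiJ_comm N l k, mul_comm, psiMat]
  rw [hcomm, hright, hdiag]
  simp only [psiMat]
  rw [hleft]
  linear_combination choose_jacobi_identity ((N : ℝ) ^ 2) j k
end

section
/- If N is an odd natural number, then 1 is an eigenvalue of the Pascal matrix T_N: there exists a nonzero vector v : Fin N → ℝ with T_N.mulVec v = v. -/
open Matrix

theorem Nat.sum_range_choose_mul_choose {n j : ℕ} (hj : j < n) (k : ℕ) :
    ∑ i ∈ Finset.range n, j.choose i * k.choose i = (j + k).choose j := by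
  rw [add_comm, Nat.add_choose_eq,
    Finset.Nat.sum_antidiagonal_eq_sum_range_succ (fun a b => k.choose a * j.choose b)]
  symm
  rw [← Finset.sum_subset (Finset.range_subset_range.2 (Nat.succ_le_of_lt hj))]
  · refine Finset.sum_congr rfl fun i hi => ?_
    rw [Nat.choose_symm (Finset.mem_range_succ_iff.1 hi), mul_comm]
  · intro i _ hi
    rw [Nat.choose_eq_zero_of_lt (by simpa using hi), zero_mul]

theorem Int.sum_range_neg_one_pow_mul_choose_mul_choose {n j : ℕ} (hj : j < n) (k : ℕ) :
    ∑ i ∈ Finset.range n, ((-1) ^ i * j.choose i * i.choose k : ℤ) =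
      if j = k then (-1) ^ k else 0 := by
  have hsub : Finset.Ico k (j + 1) ⊆ Finset.range n := by
    intro i hi
    simp only [Finset.mem_Ico, Finset.mem_range] at hi ⊢
    lia
  rw [← Finset.sum_subset hsub, Finset.sum_Ico_eq_sum_range]
  · have hterm (i : ℕ) : ((-1) ^ (k + i) * j.choose (k + i) * (k + i).choose k : ℤ) =
        (-1) ^ k * j.choose k * ((-1) ^ i * (j - k).choose i) := by
      have h := Nat.choose_mul (n := j) (Nat.le_add_right k i)
      rw [Nat.add_sub_cancel_left] at h
      rw [mul_assoc, ← Nat.cast_mul, h, pow_add]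
      push_cast
      ring
    simp only [hterm, ← Finset.mul_sum]
    rcases lt_or_ge j k with hjk | hkj
    · simp [Nat.choose_eq_zero_of_lt hjk, hjk.ne]
    · rw [Nat.sub_add_comm hkj, Int.alternating_sum_range_choose]
      rcases hkj.eq_or_lt with rfl | hlt
      · simp
      · simp [hlt.ne', Nat.sub_ne_zero_of_lt hlt]
  · intro i _ hi
    rcases lt_or_ge i k with hik | hki
    · simp [Nat.choose_eq_zero_of_lt hik]
    · have hji : j < i := by
        by_contra! h
        exact hi (Finset.mem_Ico.2 ⟨hki, Nat.lt_succ_of_le h⟩)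
      simp [Nat.choose_eq_zero_of_lt hji]

theorem pascalT_eq_psiMat_mul_transpose (N : ℕ) : pascalT N = psiMat N * (psiMat N)ᵀ := by
  ext j k
  simp only [pascalT, psiMat, mul_apply, transpose_apply]
  rw [Fin.sum_univ_eq_sum_range (fun i => ((j.1.choose i : ℝ) * (k.1.choose i : ℝ))),
    ← Nat.sum_range_choose_mul_choose j.2]
  push_cast
  rfl

theorem lamMat_mul_self (N : ℕ) : lamMat N * lamMat N = 1 := by
  simp [lamMat, diagonal_mul_diagonal, ← mul_pow]

theorem lamMat_transpose (N : ℕ) : (lamMat N)ᵀ = lamMat N :=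
  diagonal_transpose _

theorem psiMat_mul_lamMat_mul_psiMat (N : ℕ) :
    psiMat N * lamMat N * psiMat N = lamMat N := by
  ext j k
  rw [mul_apply]
  simp only [lamMat, psiMat, mul_diagonal, diagonal_apply]
  rw [Fin.sum_univ_eq_sum_range
    (fun i => ((j.1.choose i : ℝ) * (-1) ^ i * (i.choose k.1 : ℝ)))]
  have h := congrArg (Int.cast : ℤ → ℝ)
    (Int.sum_range_neg_one_pow_mul_choose_mul_choose j.2 k.1)
  push_cast at h
  simp only [mul_comm ((j.1.choose _ : ℕ) : ℝ), h, Fin.ext_iff]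
  split_ifs with hjk <;> simp [hjk]

/-- If `N` is odd, `Ψᵀ - Λ Ψ Λ` is singular: conjugating it by `Λ` gives minus its transpose. -/
theorem det_psiMat_transpose_sub_eq_zero {N : ℕ} (hN : Odd N) :
    ((psiMat N)ᵀ - lamMat N * psiMat N * lamMat N).det = 0 := by
  set X := (psiMat N)ᵀ - lamMat N * psiMat N * lamMat N with hX
  have hconj : Xᵀ = -(lamMat N * X * lamMat N) := by
    have h (A : Matrix (Fin N) (Fin N) ℝ) : lamMat N * (lamMat N * A) = A := by
      rw [← mul_assoc, lamMat_mul_self, one_mul]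
    simp only [hX, mul_sub, sub_mul, h, transpose_sub, transpose_mul, transpose_transpose,
      lamMat_transpose, lamMat_mul_self, neg_sub, mul_assoc, mul_one]
  have hdet : (lamMat N).det * (lamMat N).det = 1 := by
    rw [← det_mul, lamMat_mul_self, det_one]
  have h := congrArg det hconj
  rw [det_transpose, det_neg, Fintype.card_fin, hN.neg_one_pow, det_mul, det_mul] at h
  linear_combination h / 2 - X.det / 2 * hdet

/-- If `N` is odd, then `1` is an eigenvalue of the `N × N` Pascal matrix `T_N`. -/
theorem pascal_has_eigenvalue_one (N : ℕ) (hN : Odd N) :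
    ∃ v : Fin N → ℝ, v ≠ 0 ∧ (pascalT N).mulVec v = v := by
  obtain ⟨v, hv, hker⟩ := exists_mulVec_eq_zero_iff.2 (det_psiMat_transpose_sub_eq_zero hN)
  refine ⟨v, hv, ?_⟩
  rw [sub_mulVec, sub_eq_zero] at hker
  rw [pascalT_eq_psiMat_mul_transpose, ← mulVec_mulVec, hker, mulVec_mulVec, ← mul_assoc,
    ← mul_assoc, psiMat_mul_lamMat_mul_psiMat, lamMat_mul_self, one_mulVec]
end
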